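/- arXiv:1504.00421 — 5 statements merged into one kernel-verified Lean document; each statement's English description precedes it below -/
import Mathlib

section
/- For w ∈ (0, ∞], define the uniaxial locus U_w = { x ∈ Ω, x not on the z-axis, such that the matrix Q_{0,w}(x) has a repeated eigenvalue }, where Q_{0,w}(x) = s_*(w/(3+w))(1/r³)(e_r⊗e_r − I/3) + s_*(1 − (w/(1+w))(1/r))(e_z⊗e_z − I/3), r = |x|. Then: (i) if w > √3, U_w is exactly the circle { (x₁, x₂, 0) : x₁² + x₂² = r_w² }, where r_w is the unique solution r > 1 of r³ − (w/(1+w))r² − w/(3+w) = 0; (ii) the function w ↦ r_w is strictly increasing on (√3, ∞), with r_{√3} = 1 and r_w increasing to the finite value r_∞ > 1 solving r_∞³ − r_∞² − 1 = 0 as w → ∞; (iii) if w ≤ √3, U_w is empty. -/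
open MeasureTheory Filter Metric Real Set
open scoped ENNReal NNReal
noncomputable section

abbrev E3 : Type := EuclideanSpace ℝ (Fin 3)
abbrev Mat3 : Type := Matrix (Fin 3) (Fin 3) ℝ

def isS0 (Q : Mat3) : Prop := Q.IsSymm ∧ Q.trace = 0
def minner (A B : Mat3) : ℝ := (A * B).trace
def mnormSq (A : Mat3) : ℝ := (A * A).trace
def mnorm (A : Mat3) : ℝ := Real.sqrt (mnormSq A)
def outer (u v : E3) : Mat3 := Matrix.of fun i j => u i * v j
def ez : E3 := EuclideanSpace.single 2 1
def er (x : E3) : E3 := ‖x‖⁻¹ • x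
def sstar (a b c : ℝ) : ℝ := (b + Real.sqrt (b ^ 2 + 24 * a * c)) / (4 * c)
def Qinf (a b c : ℝ) : Mat3 := sstar a b c • (outer ez ez - (1 / 3 : ℝ) • (1 : Mat3))
def Qsurf (a b c : ℝ) (x : E3) : Mat3 :=
  sstar a b c • (outer (er x) (er x) - (1 / 3 : ℝ) • (1 : Mat3))
def Omega : Set E3 := {x | 1 < ‖x‖}
def OmegaBar : Set E3 := {x | 1 ≤ ‖x‖}

def pd (g : E3 → ℝ) (k : Fin 3) : E3 → ℝ :=
  fun x => fderivWithin ℝ g OmegaBar x (EuclideanSpace.single k 1)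
def lap3 (g : E3 → ℝ) (x : E3) : ℝ := ∑ k, pd (pd g k) k x
def matLap (Q : E3 → Mat3) (x : E3) : Mat3 := Matrix.of fun i j => lap3 (fun y => Q y i j) x
def gradSq (Q : E3 → Mat3) (x : E3) : ℝ := ∑ i, ∑ j, ∑ k, (pd (fun y => Q y i j) k x) ^ 2
def nuDeriv (Q : E3 → Mat3) (x : E3) : Mat3 :=
  Matrix.of fun i j => fderivWithin ℝ (fun y => Q y i j) OmegaBar x (-(er x))

def gradf (a b c : ℝ) (Q : Mat3) : Mat3 :=
  (-a) • Q - b • (Q * Q - (mnormSq Q / 3) • (1 : Mat3)) + (c * mnormSq Q) • Q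

def gpot (a b c : ℝ) (Q : Mat3) : ℝ :=
  -(a / 2) * (Q * Q).trace - (b / 3) * (Q * Q * Q).trace + (c / 4) * ((Q * Q).trace) ^ 2
def Cconst (a b c : ℝ) : ℝ := -sInf (gpot a b c '' {Q | isS0 Q})
def fpot (a b c : ℝ) (Q : Mat3) : ℝ := gpot a b c Q + Cconst a b c

def RegC (m : ℕ) (Q : E3 → Mat3) : Prop :=
  ∀ i j, ContDiffOn ℝ m (fun x => Q x i j) OmegaBar

def memH (a b c : ℝ) (Q : E3 → Mat3) : Prop :=
  (∀ x ∈ OmegaBar, isS0 (Q x)) ∧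
  IntegrableOn (fun x => gradSq Q x) Omega volume ∧
  IntegrableOn (fun x => mnormSq (Q x - Qinf a b c) / ‖x‖ ^ 2) Omega volume

def isEL (a b c L : ℝ) (Q : E3 → Mat3) : Prop :=
  ∀ x ∈ Omega, L • matLap Q x = gradf a b c (Q x)

def weakAnchor (a b c L W : ℝ) (Q : E3 → Mat3) : Prop :=
  ∀ x : E3, ‖x‖ = 1 → (L / W) • nuDeriv Q x = Qsurf a b c x - Q x

def coef1 (w : ℝ≥0∞) : ℝ := if w = ⊤ then 1 else w.toReal / (1 + w.toReal)
def coef3 (w : ℝ≥0∞) : ℝ := if w = ⊤ then 1 else w.toReal / (3 + w.toReal)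

def Q0 (a b c : ℝ) (w : ℝ≥0∞) (x : E3) : Mat3 :=
  (sstar a b c * coef3 w / ‖x‖ ^ 3) • (outer (er x) (er x) - (1 / 3 : ℝ) • (1 : Mat3))
  + (sstar a b c * (1 - coef1 w / ‖x‖)) • (outer ez ez - (1 / 3 : ℝ) • (1 : Mat3))

def repeatedEig (Q : Mat3) : Prop := ∃ t : ℝ, 2 ≤ Polynomial.rootMultiplicity t (Matrix.charpoly Q)

def vec3 (p q r : ℝ) : E3 := (WithLp.equiv 2 (Fin 3 → ℝ)).symm ![p, q, r]

/-- The uniaxial locus of `Q₀ = Q_{0,w}` away from the `z`-axis: points of `Ω` off the axis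
where `Q₀(x)` has a repeated eigenvalue. -/
def Uw (a b c : ℝ) (w : ℝ≥0∞) : Set E3 :=
  {x | x ∈ Omega ∧ ¬(x 0 = 0 ∧ x 1 = 0) ∧ repeatedEig (Q0 a b c w x)}

/-- The cubic `p(w,r) = r³ − (w/(1+w)) r² − w/(3+w)` (with the coefficients equal to `1`
when `w = ∞`). -/
def coefP (w : ℝ≥0∞) (r : ℝ) : ℝ := r ^ 3 - coef1 w * r ^ 2 - coef3 w

open Polynomial in
/-- The characteristic polynomial of `A (n ⊗ n - I/3) + B (m ⊗ m - I/3)` for a unit vector `n`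
and `m` the vertical unit vector. -/
lemma charpoly_smul_outer_add (A B : ℝ) (n : E3) (hn : n 0 ^ 2 + n 1 ^ 2 + n 2 ^ 2 = 1) :
    (A • (outer n n - (1 / 3 : ℝ) • (1 : Mat3)) +
      B • (outer ez ez - (1 / 3 : ℝ) • (1 : Mat3))).charpoly =
    (X + C ((A + B) / 3)) ^ 3 - C (A + B) * (X + C ((A + B) / 3)) ^ 2
      + C (A * B * (1 - n 2 ^ 2)) * (X + C ((A + B) / 3)) := by
  have h : (C (n 0) : ℝ[X]) ^ 2 + C (n 1) ^ 2 + C (n 2) ^ 2 = 1 := by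
    simp only [← C_pow, ← C_add, hn, C_1]
  have h3 : (C ((A + B) / 3) : ℝ[X]) = (C A + C B) * C (1 / 3) := by
    rw [← C_add, ← C_mul]; congr 1; ring
  rw [Matrix.charpoly, Matrix.det_fin_three, h3]
  simp only [Matrix.charmatrix_apply, outer, ez, Matrix.add_apply, Matrix.smul_apply,
    Matrix.sub_apply, Matrix.of_apply, smul_eq_mul, Matrix.one_apply, Matrix.diagonal_apply,
    PiLp.single_apply]
  simp only [Fin.isValue, Fin.reduceEq, if_true, if_false, C_add, C_sub, C_mul, C_pow, C_neg,
    mul_zero, mul_one, sub_zero, add_zero, zero_sub, map_one]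
  set T : ℝ[X] := X + (C A + C B) * C (1 / 3) with hT
  linear_combination (-C A * T ^ 2 + C A * C B * T) * h

open Polynomial in
/-- The translated cubic `Y³ - (A + B) Y² + A B k Y` with `A, B, k > 0`, `k ≤ 1` has a double root
exactly when `A = B` and `k = 1`. -/
lemma two_le_rootMultiplicity_iff {A B k : ℝ} (hA : 0 < A) (hB : 0 < B) (hk : 0 < k)
    (hk1 : k ≤ 1) (s : ℝ) :
    (∃ t : ℝ, 2 ≤ rootMultiplicity t ((X + C s) ^ 3 - C (A + B) * (X + C s) ^ 2
      + C (A * B * k) * (X + C s))) ↔ A = B ∧ k = 1 := by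
  set p : ℝ[X] := (X + C s) ^ 3 - C (A + B) * (X + C s) ^ 2 + C (A * B * k) * (X + C s) with hp
  have hev : ∀ t, p.eval t = (t + s) ^ 3 - (A + B) * (t + s) ^ 2 + A * B * k * (t + s) := by
    intro t; simp [hp]
  have hdev : ∀ t, (derivative p).eval t =
      3 * (t + s) ^ 2 - 2 * (A + B) * (t + s) + A * B * k := by
    intro t; simp [hp, derivative_pow]; ring
  have hP : 0 < A * B * k := by positivity
  have hp0 : p ≠ 0 := by
    intro h0
    have h1 := hdev (-s)
    rw [h0, derivative_zero, eval_zero, neg_add_cancel] at h1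
    linarith
  have key : ∀ t, 2 ≤ rootMultiplicity t p ↔ p.eval t = 0 ∧ (derivative p).eval t = 0 :=
    fun t => one_lt_rootMultiplicity_iff_isRoot hp0
  simp only [key, hev, hdev]
  constructor
  · rintro ⟨t, h1, h2⟩
    set Y := t + s
    have hY : Y ≠ 0 := by
      rintro h0
      rw [h0] at h2
      linarith
    have h3 : Y ^ 2 - (A + B) * Y + A * B * k = 0 := by
      apply mul_left_cancel₀ hY; linear_combination h1
    have h4 : 2 * Y - (A + B) = 0 := by
      apply mul_left_cancel₀ hY; linear_combination h2 - h3
    have hYe : Y = (A + B) / 2 := by linarith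
    have h5 : (A - B) ^ 2 + 4 * (A * B) * (1 - k) = 0 := by
      rw [hYe] at h3; linear_combination -4 * h3
    have h6 : 0 ≤ 4 * (A * B) * (1 - k) := mul_nonneg (by positivity) (by linarith)
    have h7 : (A - B) ^ 2 = 0 := by nlinarith [sq_nonneg (A - B)]
    have h8 : 4 * (A * B) * (1 - k) = 0 := by linarith
    have h9 : (4 * (A * B)) ≠ 0 := by positivity
    refine ⟨by linarith [pow_eq_zero_iff (two_ne_zero) |>.1 h7], ?_⟩
    linarith [(mul_eq_zero.1 h8).resolve_left h9]
  · rintro ⟨rfl, rfl⟩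
    exact ⟨A - s, by ring, by ring⟩

lemma norm_sq_E3 (x : E3) : ‖x‖ ^ 2 = x 0 ^ 2 + x 1 ^ 2 + x 2 ^ 2 := by
  rw [EuclideanSpace.norm_sq_eq, Fin.sum_univ_three]
  simp

lemma sstar_pos {a b c : ℝ} (hb : 0 < b) (hc : 0 < c) : 0 < sstar a b c := by
  unfold sstar
  have := Real.sqrt_nonneg (b ^ 2 + 24 * a * c)
  positivity

lemma coef1_pos {w : ℝ≥0∞} (hw : 0 < w) : 0 < coef1 w := by
  unfold coef1
  split_ifs with h
  · exact one_pos
  · have := ENNReal.toReal_pos hw.ne' h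
    positivity

lemma coef1_le_one (w : ℝ≥0∞) : coef1 w ≤ 1 := by
  unfold coef1
  split_ifs with h
  · exact le_rfl
  · have : 0 ≤ w.toReal := ENNReal.toReal_nonneg
    rw [div_le_one (by positivity)]; linarith

lemma coef3_pos {w : ℝ≥0∞} (hw : 0 < w) : 0 < coef3 w := by
  unfold coef3
  split_ifs with h
  · exact one_pos
  · have := ENNReal.toReal_pos hw.ne' h
    positivity

lemma coef3_le_one (w : ℝ≥0∞) : coef3 w ≤ 1 := by
  unfold coef3
  split_ifs with h
  · exact le_rfl
  · have : 0 ≤ w.toReal := ENNReal.toReal_nonneg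
    rw [div_le_one (by positivity)]; linarith

lemma coef1_ofReal {w : ℝ} (hw : 0 ≤ w) : coef1 (ENNReal.ofReal w) = w / (1 + w) := by
  simp [coef1, ENNReal.toReal_ofReal hw]

lemma coef3_ofReal {w : ℝ} (hw : 0 ≤ w) : coef3 (ENNReal.ofReal w) = w / (3 + w) := by
  simp [coef3, ENNReal.toReal_ofReal hw]

lemma div_const_add_lt_div {k v w : ℝ} (hk : 0 < k) (hv : 0 ≤ v) (hvw : v < w) :
    v / (k + v) < w / (k + w) := by
  have hw : 0 < w := hv.trans_lt hvw
  rw [div_lt_div_iff₀ (by positivity) (by positivity)]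
  nlinarith

lemma coefP_ofReal_one {w : ℝ} (hw : 0 ≤ w) :
    coefP (ENNReal.ofReal w) 1 = (3 - w ^ 2) / ((1 + w) * (3 + w)) := by
  rw [coefP, coef1_ofReal hw, coef3_ofReal hw]
  field_simp
  ring

lemma coefP_one_neg {w : ℝ≥0∞} (hw : ENNReal.ofReal (Real.sqrt 3) < w) : coefP w 1 < 0 := by
  induction w with
  | top => norm_num [coefP, coef1, coef3]
  | coe v =>
    have hv : Real.sqrt 3 < v := by
      rw [← ENNReal.ofReal_coe_nnreal] at hw
      exact (ENNReal.ofReal_lt_ofReal_iff_of_nonneg (Real.sqrt_nonneg 3)).1 hw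
    have h0 : (0 : ℝ) ≤ v := v.2
    rw [← ENNReal.ofReal_coe_nnreal, coefP_ofReal_one h0]
    have := (Real.sqrt_lt' ((Real.sqrt_nonneg 3).trans_lt hv)).1 hv
    exact div_neg_of_neg_of_pos (by linarith) (by positivity)

lemma coefP_one_nonneg {w : ℝ≥0∞} (hw : w ≤ ENNReal.ofReal (Real.sqrt 3)) :
    0 ≤ coefP w 1 := by
  induction w with
  | top => simp at hw
  | coe v =>
    rw [← ENNReal.ofReal_coe_nnreal] at hw ⊢
    have hv := (ENNReal.ofReal_le_ofReal_iff (Real.sqrt_nonneg 3)).1 hw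
    have h0 : (0 : ℝ) ≤ v := v.2
    rw [coefP_ofReal_one h0]
    have := (Real.le_sqrt h0 (by norm_num)).1 hv
    exact div_nonneg (by linarith) (by positivity)

/-- On `[1, ∞)` the cubic grows at least with unit slope. -/
lemma sub_le_coefP_sub (w : ℝ≥0∞) {r s : ℝ} (hr : 1 ≤ r) (hrs : r ≤ s) :
    s - r ≤ coefP w s - coefP w r := by
  have h1 := coef1_le_one w
  have e : coefP w s - coefP w r - (s - r) =
      (s - r) * ((s ^ 2 + s * r + r ^ 2 - (s + r) - 1) + (1 - coef1 w) * (s + r)) := by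
    unfold coefP; ring
  have h2 : 0 ≤ s ^ 2 + s * r + r ^ 2 - (s + r) - 1 := by nlinarith
  have h3 : 0 ≤ (1 - coef1 w) * (s + r) := mul_nonneg (by linarith) (by linarith)
  have h4 := mul_nonneg (sub_nonneg.2 hrs) (add_nonneg h2 h3)
  linarith

lemma lt_of_coefP_lt {w : ℝ≥0∞} {r s : ℝ} (hs : 1 ≤ s) (h : coefP w r < coefP w s) :
    r < s := by
  by_contra! hsr
  linarith [sub_le_coefP_sub w hs hsr]

lemma eq_of_coefP_eq {w : ℝ≥0∞} {r s : ℝ} (hr : 1 ≤ r) (hs : 1 ≤ s)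
    (h : coefP w r = coefP w s) : r = s := by
  rcases le_total r s with hrs | hrs
  · linarith [sub_le_coefP_sub w hr hrs]
  · linarith [sub_le_coefP_sub w hs hrs]

lemma exists_coefP_eq_zero {w : ℝ≥0∞} (hw : ENNReal.ofReal (Real.sqrt 3) < w) :
    ∃ r : ℝ, 1 < r ∧ coefP w r = 0 := by
  have h1 := coefP_one_neg hw
  have h2 : 0 < coefP w 2 := by
    unfold coefP; linarith [coef1_le_one w, coef3_le_one w]
  have hcont : Continuous (coefP w) := by unfold coefP; fun_prop
  obtain ⟨r, hr, hr0⟩ := intermediate_value_Icc (by norm_num : (1 : ℝ) ≤ 2) hcont.continuousOn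
    ⟨h1.le, h2.le⟩
  refine ⟨r, lt_of_le_of_ne hr.1 ?_, hr0⟩
  rintro rfl
  linarith

/-- Points of the uniaxial locus are the equatorial points whose norm is a root of the cubic. -/
lemma mem_Uw_iff {a b c : ℝ} (hb : 0 < b) (hc : 0 < c) {w : ℝ≥0∞} (hw : 0 < w) (x : E3) :
    x ∈ Uw a b c w ↔ 1 < ‖x‖ ∧ x 2 = 0 ∧ coefP w ‖x‖ = 0 := by
  have hiff : 1 < ‖x‖ → ¬(x 0 = 0 ∧ x 1 = 0) →
      (repeatedEig (Q0 a b c w x) ↔ x 2 = 0 ∧ coefP w ‖x‖ = 0) := by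
    intro hx hax
    have hpos : 0 < ‖x‖ := by linarith
    have hs := sstar_pos (a := a) hb hc
    have h3 := coef3_pos hw
    have hA : 0 < sstar a b c * coef3 w / ‖x‖ ^ 3 := by positivity
    have hB : 0 < sstar a b c * (1 - coef1 w / ‖x‖) := by
      refine mul_pos hs (sub_pos.2 ?_)
      rw [div_lt_one hpos]
      linarith [coef1_le_one w]
    have hsq := norm_sq_E3 x
    have her : ∀ i, er x i = x i / ‖x‖ := fun i => by simp [er, div_eq_inv_mul]
    have hn : er x 0 ^ 2 + er x 1 ^ 2 + er x 2 ^ 2 = 1 := by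
      simp only [her]; field_simp; exact hsq.symm
    have hk : 0 < 1 - er x 2 ^ 2 := by
      have : 0 < x 0 ^ 2 + x 1 ^ 2 := by
        rcases not_and_or.1 hax with h | h <;> positivity
      have e : 1 - er x 2 ^ 2 = (x 0 ^ 2 + x 1 ^ 2) / ‖x‖ ^ 2 := by
        rw [her]; field_simp; linarith
      rw [e]; positivity
    have hk1 : 1 - er x 2 ^ 2 ≤ 1 := by linarith [sq_nonneg (er x 2)]
    rw [repeatedEig, Q0, charpoly_smul_outer_add _ _ _ hn,
      two_le_rootMultiplicity_iff hA hB hk hk1, and_comm]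
    refine and_congr ?_ ?_
    · rw [sub_eq_self, her, sq_eq_zero_iff, div_eq_zero_iff, or_iff_left hpos.ne']
    · rw [mul_div_assoc, mul_right_inj' hs.ne', div_eq_iff (by positivity), coefP]
      have e : (1 - coef1 w / ‖x‖) * ‖x‖ ^ 3 = ‖x‖ ^ 3 - coef1 w * ‖x‖ ^ 2 := by
        field_simp
      rw [e]
      constructor <;> intro h <;> linarith
  constructor
  · rintro ⟨hx, hax, hrep⟩
    exact ⟨hx, (hiff hx hax).1 hrep⟩
  · rintro ⟨hx, hx2, hP⟩
    have hax : ¬(x 0 = 0 ∧ x 1 = 0) := by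
      rintro ⟨h0, h1⟩
      have := norm_sq_E3 x
      rw [h0, h1, hx2] at this
      nlinarith
    exact ⟨hx, hax, (hiff hx hax).2 ⟨hx2, hP⟩⟩

lemma coefP_lt_of_lt {v w : ℝ} (hv : 0 ≤ v) (hvw : v < w) (r : ℝ) :
    coefP (ENNReal.ofReal w) r < coefP (ENNReal.ofReal v) r := by
  have hw : 0 ≤ w := hv.trans hvw.le
  rw [coefP, coefP, coef1_ofReal hv, coef3_ofReal hv, coef1_ofReal hw, coef3_ofReal hw]
  have h1 := div_const_add_lt_div one_pos hv hvw
  have h3 := div_const_add_lt_div three_pos hv hvw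
  have := mul_le_mul_of_nonneg_right h1.le (sq_nonneg r)
  linarith

lemma coefP_top (r : ℝ) : coefP ⊤ r = r ^ 3 - r ^ 2 - 1 := by
  simp [coefP, coef1, coef3]

lemma coefP_ofReal_sub_top {w : ℝ} (hw : 0 ≤ w) (r : ℝ) :
    coefP (ENNReal.ofReal w) r - coefP ⊤ r = r ^ 2 / (1 + w) + 3 / (3 + w) := by
  rw [coefP_top, coefP, coef1_ofReal hw, coef3_ofReal hw]
  field_simp
  ring

/-- Proposition 3.2: for `w > √3` the uniaxial locus of `Q_{0,w}` is exactly
the Saturn-ring circle of radius `r_w`, the unique root `r > 1` of `p(w,r) = 0`;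
`w ↦ r_w` is strictly increasing, with boundary value `1` at `w = √3` and increasing to the
root `r_∞ > 1` of `r³ − r² − 1 = 0` as `w → ∞`; for `w ≤ √3` the locus is empty. -/
theorem saturn_ring_locus
    (a b c : ℝ) (ha : 0 ≤ a) (hb : 0 < b) (hc : 0 < c) :
    (∀ w : ℝ≥0∞, ENNReal.ofReal (Real.sqrt 3) < w →
      ∃ rw : ℝ, (1 < rw ∧ coefP w rw = 0) ∧
        (∀ r : ℝ, 1 < r → coefP w r = 0 → r = rw) ∧
        Uw a b c w = {x : E3 | x 2 = 0 ∧ (x 0) ^ 2 + (x 1) ^ 2 = rw ^ 2}) ∧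
    (∃ rfun : ℝ → ℝ,
      (∀ w : ℝ, Real.sqrt 3 < w → 1 < rfun w ∧ coefP (ENNReal.ofReal w) (rfun w) = 0) ∧
      StrictMonoOn rfun (Set.Ioi (Real.sqrt 3)) ∧
      coefP (ENNReal.ofReal (Real.sqrt 3)) 1 = 0 ∧
      (∃ rinf : ℝ, 1 < rinf ∧ rinf ^ 3 - rinf ^ 2 - 1 = 0 ∧
        (∀ w : ℝ, Real.sqrt 3 < w → rfun w < rinf) ∧
        Filter.Tendsto rfun Filter.atTop (nhds rinf))) ∧
    (∀ w : ℝ≥0∞, 0 < w → w ≤ ENNReal.ofReal (Real.sqrt 3) → Uw a b c w = ∅) := by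
  have hs3 : 0 < Real.sqrt 3 := Real.sqrt_pos.2 (by norm_num)
  refine ⟨fun w hw => ?_, ?_, fun w hw0 hw => ?_⟩
  · have hw0 : 0 < w := zero_le.trans_lt hw
    obtain ⟨r, hr1, hr⟩ := exists_coefP_eq_zero hw
    have huniq : ∀ s : ℝ, 1 < s → coefP w s = 0 → s = r := fun s hs1 hs =>
      eq_of_coefP_eq hs1.le hr1.le (hs.trans hr.symm)
    refine ⟨r, ⟨hr1, hr⟩, huniq, ?_⟩
    ext x
    rw [mem_Uw_iff hb hc hw0]
    have hsq := norm_sq_E3 x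
    constructor
    · rintro ⟨hx, hx2, hP⟩
      refine ⟨hx2, ?_⟩
      rw [← huniq _ hx hP, hsq, hx2]
      ring
    · rintro ⟨hx2, hx⟩
      have hnorm : ‖x‖ = r := by
        rw [← sq_eq_sq₀ (norm_nonneg x) (by linarith), hsq, hx, hx2]
        ring
      rw [hnorm]
      exact ⟨hr1, hx2, hr⟩
  · have hex : ∀ w : ℝ, ∃ r : ℝ, Real.sqrt 3 < w →
        1 < r ∧ coefP (ENNReal.ofReal w) r = 0 := by
      intro w
      by_cases hw : Real.sqrt 3 < w
      · obtain ⟨r, hr⟩ := exists_coefP_eq_zero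
          ((ENNReal.ofReal_lt_ofReal_iff_of_nonneg hs3.le).2 hw)
        exact ⟨r, fun _ => hr⟩
      · exact ⟨0, fun h => absurd h hw⟩
    choose f hf using hex
    obtain ⟨R, hR1, hR⟩ := exists_coefP_eq_zero (w := ⊤) ENNReal.ofReal_lt_top
    have hlt : ∀ w : ℝ, Real.sqrt 3 < w → f w < R := by
      intro w hw
      have hw0 : 0 < w := hs3.trans hw
      refine lt_of_coefP_lt (w := ⊤) hR1.le ?_
      have h := coefP_ofReal_sub_top hw0.le (f w)
      rw [(hf w hw).2] at h
      have : 0 < f w ^ 2 / (1 + w) + 3 / (3 + w) := by positivity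
      linarith
    refine ⟨f, hf, ?_, ?_, R, hR1, (coefP_top R).symm.trans hR, hlt, ?_⟩
    · intro v hv w hw hvw
      have hv' : Real.sqrt 3 < v := hv
      refine lt_of_coefP_lt (w := ENNReal.ofReal w) (hf w hw).1.le ?_
      rw [(hf w hw).2, ← (hf v hv).2]
      exact coefP_lt_of_lt (hs3.trans hv').le hvw (f v)
    · rw [coefP_ofReal_one hs3.le, Real.sq_sqrt (by norm_num)]
      simp
    · have hlim : Tendsto (fun w : ℝ => R - (R ^ 2 + 3) / w) atTop (nhds R) := by
        simpa using tendsto_const_nhds.sub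
          ((tendsto_const_nhds (x := R ^ 2 + 3)).div_atTop (tendsto_id (α := ℝ)))
      refine tendsto_of_tendsto_of_tendsto_of_le_of_le' hlim tendsto_const_nhds ?_ ?_
      · filter_upwards [eventually_gt_atTop (Real.sqrt 3)] with w hw
        have hw0 : 0 < w := hs3.trans hw
        have h := coefP_ofReal_sub_top hw0.le (f w)
        have hf1 := (hf w hw).1
        have hfR := hlt w hw
        have hle := sub_le_coefP_sub ⊤ hf1.le hfR.le
        rw [(hf w hw).2] at h
        have h1 : f w ^ 2 / (1 + w) ≤ R ^ 2 / w := by gcongr; linarith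
        have h2 : 3 / (3 + w) ≤ 3 / w := by gcongr; linarith
        rw [add_div]
        linarith
      · filter_upwards [eventually_gt_atTop (Real.sqrt 3)] with w hw
        exact (hlt w hw).le
  · refine Set.eq_empty_of_forall_notMem fun x hx => ?_
    obtain ⟨hx1, -, hP⟩ := (mem_Uw_iff hb hc hw0 x).1 hx
    linarith [sub_le_coefP_sub w le_rfl hx1.le, coefP_one_nonneg hw]
end
end

section
/- Let u, v be unit vectors in ℝ³ with u·v = cos φ, let α, β ∈ ℝ, and set Q = α(u⊗u − I/3) + β(v⊗v − I/3), σ = α + β, ν = αβ. Then the characteristic polynomial of Q is det(XI − Q) = (X + σ/3)(X² − (σ/3)X − (2/9)σ² + ν sin²φ), and σ²/4 − ν sin²φ = (α−β)²/4 + ν cos²φ. In particular, if αβ ≥ 0 then σ²/4 − ν sin²φ ≥ 0 and the eigenvalues of Q are −σ/3, σ/6 + √(σ²/4 − ν sin²φ), and σ/6 − √(σ²/4 − ν sin²φ). -/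
open MeasureTheory Filter Metric Real Set
open scoped ENNReal NNReal
noncomputable section

/-- Euclidean dot product on `ℝ³`. -/
def dot3 (u v : E3) : ℝ := ∑ i, u i * v i

/-- The squared Euclidean norm of a vector of `ℝ³` is its dot product with itself. -/
theorem dot3_self (u : E3) : dot3 u u = ‖u‖ ^ 2 := by
  rw [EuclideanSpace.real_norm_sq_eq]
  simp only [dot3, sq]

/-- The determinant of `y I − α u⊗u − β v⊗v` in terms of the Gram matrix of `u, v`. -/
theorem det_smul_one_sub_outer (u v : E3) (α β y : ℝ) :
    (y • (1 : Mat3) - (α • outer u u + β • outer v v)).det =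
      y * (y ^ 2 - (α * dot3 u u + β * dot3 v v) * y +
        α * β * (dot3 u u * dot3 v v - dot3 u v ^ 2)) := by
  simp [Matrix.det_fin_three, outer, dot3, Fin.sum_univ_three]
  ring

/-- characteristic polynomial of `Q = α(u⊗u − I/3) + β(v⊗v − I/3)` for unit
vectors `u, v` with `u·v = cos φ`: it equals `(X + σ/3)(X² − (σ/3)X − (2/9)σ² + ν sin²φ)`
with `σ = α+β`, `ν = αβ`; moreover `σ²/4 − ν sin²φ = (α−β)²/4 + ν cos²φ`, and if `αβ ≥ 0`
the eigenvalues are `−σ/3` and `σ/6 ± √(σ²/4 − ν sin²φ)`. -/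
theorem charpoly_two_projections
    (u v : E3) (hu : ‖u‖ = 1) (hv : ‖v‖ = 1)
    (φ α β : ℝ) (huv : dot3 u v = Real.cos φ) :
    (Matrix.charpoly
        (α • (outer u u - (1 / 3 : ℝ) • (1 : Mat3)) +
         β • (outer v v - (1 / 3 : ℝ) • (1 : Mat3))) =
      (Polynomial.X + Polynomial.C ((α + β) / 3)) *
      (Polynomial.X ^ 2 - Polynomial.C ((α + β) / 3) * Polynomial.X +
        Polynomial.C (-(2 / 9) * (α + β) ^ 2 + α * β * Real.sin φ ^ 2))) ∧
    ((α + β) ^ 2 / 4 - α * β * Real.sin φ ^ 2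
      = (α - β) ^ 2 / 4 + α * β * Real.cos φ ^ 2) ∧
    (0 ≤ α * β →
      0 ≤ (α + β) ^ 2 / 4 - α * β * Real.sin φ ^ 2 ∧
      Matrix.charpoly
          (α • (outer u u - (1 / 3 : ℝ) • (1 : Mat3)) +
           β • (outer v v - (1 / 3 : ℝ) • (1 : Mat3))) =
        (Polynomial.X - Polynomial.C (-((α + β) / 3))) *
        (Polynomial.X - Polynomial.C ((α + β) / 6 +
          Real.sqrt ((α + β) ^ 2 / 4 - α * β * Real.sin φ ^ 2))) *
        (Polynomial.X - Polynomial.C ((α + β) / 6 -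
          Real.sqrt ((α + β) ^ 2 / 4 - α * β * Real.sin φ ^ 2)))) := by
  have hsin : Real.sin φ ^ 2 = 1 - Real.cos φ ^ 2 := Real.sin_sq φ
  have hchar : Matrix.charpoly
        (α • (outer u u - (1 / 3 : ℝ) • (1 : Mat3)) +
         β • (outer v v - (1 / 3 : ℝ) • (1 : Mat3))) =
      (Polynomial.X + Polynomial.C ((α + β) / 3)) *
      (Polynomial.X ^ 2 - Polynomial.C ((α + β) / 3) * Polynomial.X +
        Polynomial.C (-(2 / 9) * (α + β) ^ 2 + α * β * Real.sin φ ^ 2)) := by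
    refine Polynomial.funext fun x => ?_
    have hshift : Matrix.scalar (Fin 3) x -
        (α • (outer u u - (1 / 3 : ℝ) • (1 : Mat3)) +
         β • (outer v v - (1 / 3 : ℝ) • (1 : Mat3))) =
        (x + (α + β) / 3) • (1 : Mat3) - (α • outer u u + β • outer v v) := by
      rw [Matrix.scalar_apply, ← Matrix.smul_one_eq_diagonal]
      module
    rw [Matrix.eval_charpoly, hshift, det_smul_one_sub_outer, dot3_self, dot3_self, hu, hv, huv]
    simp only [Polynomial.eval_mul, Polynomial.eval_add, Polynomial.eval_sub, Polynomial.eval_pow,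
      Polynomial.eval_X, Polynomial.eval_C, hsin]
    ring
  have hdisc : (α + β) ^ 2 / 4 - α * β * Real.sin φ ^ 2
      = (α - β) ^ 2 / 4 + α * β * Real.cos φ ^ 2 := by
    rw [hsin]
    ring
  refine ⟨hchar, hdisc, fun hαβ => ?_⟩
  have hnonneg : 0 ≤ (α + β) ^ 2 / 4 - α * β * Real.sin φ ^ 2 := by
    rw [hdisc]
    positivity
  refine ⟨hnonneg, ?_⟩
  rw [hchar]
  refine Polynomial.funext fun x => ?_
  simp only [Polynomial.eval_mul, Polynomial.eval_add, Polynomial.eval_sub, Polynomial.eval_pow,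
    Polynomial.eval_X, Polynomial.eval_C]
  linear_combination (x + (α + β) / 3) * Real.sq_sqrt hnonneg
end
end

section
/- Let u, v be unit vectors in ℝ³ with u·v = cos φ, where 0 < φ < π, let α > 0, β > 0, and set Q = α(u⊗u − I/3) + β(v⊗v − I/3), σ = α + β, ν = αβ. Denote the eigenvalues λ₁ = σ/6 + √(σ²/4 − ν sin²φ), λ₂ = σ/6 − √(σ²/4 − ν sin²φ), λ₃ = −σ/3 (so λ₁ ≥ λ₂ ≥ λ₃). Then λ₁ = λ₂ holds if and only if φ = π/2 and α = β, while λ₂ = λ₃ never holds. Consequently Q has a repeated eigenvalue if and only if φ = π/2 and α = β. -/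
open MeasureTheory Filter Metric Real Set
open scoped ENNReal NNReal
noncomputable section

open Polynomial in
theorem exists_two_le_rootMultiplicity_iff (a b c : ℝ) :
    (∃ t, 2 ≤ rootMultiplicity t ((X - C a) * (X - C b) * (X - C c))) ↔
      a = b ∨ b = c ∨ a = c := by
  have h : (X - C a) * (X - C b) * (X - C c) =
      (({a, b, c} : Multiset ℝ).map fun r => X - C r).prod := by
    simp [mul_assoc]
  simp only [h, ← count_roots, roots_multiset_prod_X_sub_C, Multiset.insert_eq_cons,
    Multiset.count_cons, Multiset.count_singleton]
  constructor
  · rintro ⟨t, ht⟩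
    by_contra! hne
    grind
  · rintro (rfl | rfl | rfl)
    · exact ⟨a, by simp⟩
    · exact ⟨b, by simp⟩
    · exact ⟨a, by simp⟩

theorem dot3_self_of_norm_eq_one {u : E3} (hu : ‖u‖ = 1) : dot3 u u = 1 := by
  have h := EuclideanSpace.real_norm_sq_eq u
  rw [hu] at h
  simp only [dot3, ← sq, ← h, one_pow]

theorem det_scalar_sub_outer_add_outer (u v : E3) (α β x : ℝ) :
    (x • (1 : Mat3) - (α • outer u u + β • outer v v)).det =
      x * (x ^ 2 - (α * dot3 u u + β * dot3 v v) * x +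
        α * β * (dot3 u u * dot3 v v - dot3 u v ^ 2)) := by
  simp [Matrix.det_fin_three, outer, dot3, Fin.sum_univ_three]
  ring

open Polynomial in
theorem charpoly_biaxial {u v : E3} (hu : ‖u‖ = 1) (hv : ‖v‖ = 1) {φ α β D : ℝ}
    (huv : dot3 u v = Real.cos φ)
    (hD : D ^ 2 = (α + β) ^ 2 / 4 - α * β * Real.sin φ ^ 2) :
    Matrix.charpoly (α • (outer u u - (1 / 3 : ℝ) • (1 : Mat3)) +
        β • (outer v v - (1 / 3 : ℝ) • (1 : Mat3))) =
      (X - C ((α + β) / 6 + D)) * (X - C ((α + β) / 6 - D)) * (X - C (-((α + β) / 3))) := by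
  refine Polynomial.funext fun t => ?_
  have hdet := det_scalar_sub_outer_add_outer u v α β (t + (α + β) / 3)
  rw [dot3_self_of_norm_eq_one hu, dot3_self_of_norm_eq_one hv, huv] at hdet
  rw [Matrix.eval_charpoly]
  have hM : Matrix.scalar (Fin 3) t - (α • (outer u u - (1 / 3 : ℝ) • (1 : Mat3)) +
      β • (outer v v - (1 / 3 : ℝ) • (1 : Mat3))) =
      (t + (α + β) / 3) • (1 : Mat3) - (α • outer u u + β • outer v v) := by
    rw [Matrix.scalar_apply, ← Matrix.smul_one_eq_diagonal]
    module
  rw [hM, hdet]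
  simp only [eval_mul, eval_sub, eval_X, eval_C]
  linear_combination (t + (α + β) / 3) * (hD - α * β * Real.sin_sq_add_cos_sq φ)

/-- for `Q = α(u⊗u − I/3) + β(v⊗v − I/3)` with `α, β > 0` and `0 < φ < π`,
the eigenvalues `λ₁ = σ/6 + √(σ²/4 − ν sin²φ)`, `λ₂ = σ/6 − √(σ²/4 − ν sin²φ)`,
`λ₃ = −σ/3` satisfy: `λ₁ = λ₂` iff `φ = π/2` and `α = β`; `λ₂ = λ₃` never; hence `Q` has a
repeated eigenvalue iff `φ = π/2` and `α = β`. -/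
theorem uniaxiality_criterion
    (u v : E3) (hu : ‖u‖ = 1) (hv : ‖v‖ = 1)
    (φ α β : ℝ) (hφ0 : 0 < φ) (hφπ : φ < Real.pi)
    (hα : 0 < α) (hβ : 0 < β) (huv : dot3 u v = Real.cos φ) :
    (((α + β) / 6 + Real.sqrt ((α + β) ^ 2 / 4 - α * β * Real.sin φ ^ 2)
        = (α + β) / 6 - Real.sqrt ((α + β) ^ 2 / 4 - α * β * Real.sin φ ^ 2))
      ↔ (φ = Real.pi / 2 ∧ α = β)) ∧
    ((α + β) / 6 - Real.sqrt ((α + β) ^ 2 / 4 - α * β * Real.sin φ ^ 2)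
      ≠ -((α + β) / 3)) ∧
    (repeatedEig
        (α • (outer u u - (1 / 3 : ℝ) • (1 : Mat3)) +
         β • (outer v v - (1 / 3 : ℝ) • (1 : Mat3)))
      ↔ (φ = Real.pi / 2 ∧ α = β)) := by
  have hs : 0 < Real.sin φ := Real.sin_pos_of_pos_of_lt_pi hφ0 hφπ
  have hsc := Real.sin_sq_add_cos_sq φ
  have hνc : 0 ≤ α * β * Real.cos φ ^ 2 := by positivity
  have hνs : 0 < α * β * Real.sin φ ^ 2 := by positivity
  have hdisc : (α + β) ^ 2 / 4 - α * β * Real.sin φ ^ 2 =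
      (α - β) ^ 2 / 4 + α * β * Real.cos φ ^ 2 := by
    linear_combination -(α * β) * hsc
  have hnonneg : 0 ≤ (α + β) ^ 2 / 4 - α * β * Real.sin φ ^ 2 := by
    rw [hdisc]; positivity
  have hD := Real.sq_sqrt hnonneg
  have hD0 := Real.sqrt_nonneg ((α + β) ^ 2 / 4 - α * β * Real.sin φ ^ 2)
  have hDzero : Real.sqrt ((α + β) ^ 2 / 4 - α * β * Real.sin φ ^ 2) = 0 ↔
      φ = Real.pi / 2 ∧ α = β := by
    rw [Real.sqrt_eq_zero hnonneg, hdisc]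
    constructor
    · intro h
      have hc : α * β * Real.cos φ ^ 2 = 0 := by linarith [sq_nonneg (α - β)]
      have hαβ : (α - β) ^ 2 = 0 := by linarith
      have hcos : Real.cos φ = 0 := by simpa [hα.ne', hβ.ne'] using hc
      refine ⟨Real.injOn_cos ⟨hφ0.le, hφπ.le⟩ ⟨by positivity, by linarith⟩ ?_,
        sub_eq_zero.mp (pow_eq_zero_iff two_ne_zero |>.mp hαβ)⟩
      rw [hcos, Real.cos_pi_div_two]
    · rintro ⟨rfl, rfl⟩
      simp
  rw [repeatedEig, charpoly_biaxial hu hv huv hD, exists_two_le_rootMultiplicity_iff, ← hDzero]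
  set D := Real.sqrt ((α + β) ^ 2 / 4 - α * β * Real.sin φ ^ 2)
  have hDlt : D < (α + β) / 2 := by
    refine lt_of_pow_lt_pow_left₀ 2 (by positivity) ?_
    rw [hD]; linarith
  have h12 : (α + β) / 6 + D = (α + β) / 6 - D ↔ D = 0 :=
    ⟨fun h => by linarith, fun h => by linarith⟩
  have h23 : (α + β) / 6 - D ≠ -((α + β) / 3) := fun h => by linarith
  have h13 : (α + β) / 6 + D ≠ -((α + β) / 3) := fun h => by linarith
  exact ⟨h12, h23, by simp only [h12, h23, h13, or_false]⟩
end
end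

section
/- Let a ≥ 0, b > 0, c > 0, f(Q) = −(a/2)tr(Q²) − (b/3)tr(Q³) + (c/4)(tr(Q²))² + C₀ on S₀, with C₀ chosen so that min f = 0, and let U_* = {s_*(n⊗n − I/3) : n ∈ S²} with s_* = (b + √(b² + 24ac))/(4c). Then there exists a constant C₃ > 0 depending only on a, b, c such that dist(Q, U_*)² ≤ C₃ f(Q) for every Q ∈ S₀, where dist(Q, U_*) = min_{P ∈ U_*} |Q − P| in the norm |Q|² = tr(Q²). -/
open MeasureTheory Filter Metric Real Set
open scoped ENNReal NNReal
noncomputable section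

/-- Distance (in the Frobenius norm `|Q|² = tr(Q²)`) from `Q` to the uniaxial manifold
`U_* = { s_*(n⊗n − I/3) : n ∈ S² }`. -/
def distUstar (a b c : ℝ) (Q : Mat3) : ℝ :=
  sInf {d : ℝ | ∃ n : E3, ‖n‖ = 1 ∧
    d = mnorm (Q - sstar a b c • (outer n n - (1 / 3 : ℝ) • (1 : Mat3)))}

open Unitary in
/-- The trace of a power of a real symmetric matrix is the power sum of its eigenvalues. -/
lemma trace_pow_eq_sum_eigenvalues_pow {n : Type*} [Fintype n] [DecidableEq n]
    {A : Matrix n n ℝ} (hA : A.IsHermitian) (k : ℕ) :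
    (A ^ k).trace = ∑ i, hA.eigenvalues i ^ k := by
  conv_lhs => rw [hA.spectral_theorem, ← map_pow, conjStarAlgAut_apply, Matrix.trace_mul_cycle]
  simp [Matrix.diagonal_pow, Matrix.trace_diagonal]

/-- Scalar invariants of a traceless symmetric matrix: its largest eigenvalue is `2 s / 3`, the
other two eigenvalues are `-s / 3 ± √w`, and `n` is a unit eigenvector for the largest one. -/
lemma exists_invariants_of_isS0 {Q : Mat3} (hQ : isS0 Q) :
    ∃ (s w : ℝ) (n : E3), 0 ≤ s ∧ 0 ≤ w ∧ w ≤ s ^ 2 ∧ ‖n‖ = 1 ∧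
      Q.mulVec n = (2 / 3 * s) • ⇑n ∧
      (Q * Q).trace = 2 / 3 * s ^ 2 + 2 * w ∧
      (Q * Q * Q).trace = 2 / 9 * (s ^ 3 - 9 * s * w) := by
  obtain ⟨hsymm, htr⟩ := hQ
  have hH : Q.IsHermitian := by
    rw [Matrix.IsHermitian, Matrix.conjTranspose_eq_transpose_of_trivial]; exact hsymm
  set l := hH.eigenvalues with hl
  have h1 := trace_pow_eq_sum_eigenvalues_pow hH 1
  have h2 := trace_pow_eq_sum_eigenvalues_pow hH 2
  have h3 := trace_pow_eq_sum_eigenvalues_pow hH 3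
  simp only [pow_one, htr, ← hl] at h1
  rw [pow_two Q, ← hl] at h2
  rw [pow_succ Q, pow_two Q, ← hl] at h3
  obtain ⟨i, hi⟩ := Finite.exists_max l
  obtain ⟨j, k, hsum⟩ : ∃ j k : Fin 3, ∀ f : Fin 3 → ℝ, ∑ m, f m = f i + f j + f k := by
    fin_cases i
    · exact ⟨1, 2, fun f => by simp [Fin.sum_univ_three]⟩
    · exact ⟨0, 2, fun f => by simp [Fin.sum_univ_three]; ring⟩
    · exact ⟨0, 1, fun f => by simp [Fin.sum_univ_three]; ring⟩
  rw [hsum] at h1 h2 h3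
  have hj := hi j
  have hk := hi k
  have hlk : l k = -l i - l j := by linarith
  refine ⟨3 / 2 * l i, (l j - l k) ^ 2 / 4, hH.eigenvectorBasis i, by linarith, by positivity,
    ?_, hH.eigenvectorBasis.orthonormal.1 i, ?_, ?_, ?_⟩
  · rw [hlk] at hk ⊢
    nlinarith [mul_nonneg (sub_nonneg.2 hj) (sub_nonneg.2 hk)]
  · rw [hH.mulVec_eigenvectorBasis i, ← hl]
    congr 1
    ring
  · rw [h2, hlk]; ring
  · rw [h3, hlk]; ring

lemma mnormSq_sub_uniaxial {Q : Mat3} (hQ : isS0 Q) {n : E3} (hn : ‖n‖ = 1) {t : ℝ}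
    (hev : Q.mulVec n = t • ⇑n) (S : ℝ) :
    mnormSq (Q - S • (outer n n - (1 / 3 : ℝ) • (1 : Mat3)))
      = (Q * Q).trace - 2 * S * t + 2 / 3 * S ^ 2 := by
  have hn2 : n 0 ^ 2 + n 1 ^ 2 + n 2 ^ 2 = 1 := by
    have h := EuclideanSpace.norm_sq_eq n
    rw [hn] at h
    simpa [Fin.sum_univ_three] using h.symm
  have htr : Q 0 0 + Q 1 1 + Q 2 2 = 0 := by
    simpa [Matrix.trace, Fin.sum_univ_three] using hQ.2
  have e0 := congrFun hev 0
  have e1 := congrFun hev 1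
  have e2 := congrFun hev 2
  simp only [Matrix.mulVec, dotProduct, Fin.sum_univ_three, Pi.smul_apply, smul_eq_mul]
    at e0 e1 e2
  simp [mnormSq, Matrix.trace, Matrix.mul_apply, Fin.sum_univ_three, outer, Matrix.one_apply]
  linear_combination (-2 * S * n 0) * e0 + (-2 * S * n 1) * e1 + (-2 * S * n 2) * e2
    + (2 / 3 * S) * htr
    + (-2 * S * t + S ^ 2 * (n 0 ^ 2 + n 1 ^ 2 + n 2 ^ 2 + 1) - 2 / 3 * S ^ 2) * hn2

lemma isS0_and_traces_uniaxial (S : ℝ) {n : E3} (hn : ‖n‖ = 1) :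
    isS0 (S • (outer n n - (1 / 3 : ℝ) • (1 : Mat3))) ∧
    ((S • (outer n n - (1 / 3 : ℝ) • (1 : Mat3))) *
      (S • (outer n n - (1 / 3 : ℝ) • (1 : Mat3)))).trace = 2 / 3 * S ^ 2 ∧
    ((S • (outer n n - (1 / 3 : ℝ) • (1 : Mat3))) *
      (S • (outer n n - (1 / 3 : ℝ) • (1 : Mat3))) *
      (S • (outer n n - (1 / 3 : ℝ) • (1 : Mat3)))).trace = 2 / 9 * S ^ 3 := by
  have hn2 : n 0 ^ 2 + n 1 ^ 2 + n 2 ^ 2 = 1 := by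
    have h := EuclideanSpace.norm_sq_eq n
    rw [hn] at h
    simpa [Fin.sum_univ_three] using h.symm
  have hP : outer n n * outer n n = outer n n := by
    ext i j
    simp only [Matrix.mul_apply, Fin.sum_univ_three, outer, Matrix.of_apply]
    linear_combination (n i * n j) * hn2
  have htr : (outer n n).trace = 1 := by
    simp only [Matrix.trace, Fin.sum_univ_three, outer, Matrix.of_apply, Matrix.diag_apply]
    linear_combination hn2
  refine ⟨⟨?_, ?_⟩, ?_, ?_⟩
  · ext i j
    simp [outer, Matrix.one_apply, eq_comm, mul_comm]
  · simp [htr]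
  · simp [sub_mul, mul_sub, hP, htr]
    ring
  · simp [sub_mul, mul_sub, hP, htr]
    ring

/-- The bulk potential of a uniaxial tensor with scalar order parameter `s`. -/
def uniaxialPot (a b c s : ℝ) : ℝ := -(a / 3) * s ^ 2 - 2 * b / 27 * s ^ 3 + c / 9 * s ^ 4

/-- The quadratic growth constant of `uniaxialPot` at its minimiser `S`. -/
def uniaxialGrowth (b c S : ℝ) : ℝ := S * (3 * S * c - b) / 27

lemma sstar_root {a b c : ℝ} (ha : 0 ≤ a) (hc : 0 < c) :
    2 * c * sstar a b c ^ 2 = b * sstar a b c + 3 * a := by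
  have h := Real.sq_sqrt (show 0 ≤ b ^ 2 + 24 * a * c by positivity)
  unfold sstar
  generalize √(b ^ 2 + 24 * a * c) = r at h
  field_simp
  linear_combination 2 * h

lemma three_mul_sstar_sub_pos {a b c : ℝ} (ha : 0 ≤ a) (hb : 0 < b) (hc : 0 < c) :
    0 < 3 * sstar a b c * c - b := by
  have hS := sstar_pos (a := a) hb hc
  have h := sstar_root (b := b) ha hc
  by_contra! hcon
  nlinarith [mul_pos hb hS, mul_nonneg hS.le (sub_nonneg.2 hcon)]

lemma uniaxialGrowth_pos {a b c : ℝ} (ha : 0 ≤ a) (hb : 0 < b) (hc : 0 < c) :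
    0 < uniaxialGrowth b c (sstar a b c) := by
  have := sstar_pos (a := a) hb hc
  have := three_mul_sstar_sub_pos ha hb hc
  unfold uniaxialGrowth
  positivity

lemma uniaxialPot_growth {a b c s : ℝ} (ha : 0 ≤ a) (hb : 0 < b) (hc : 0 < c) (hs : 0 ≤ s) :
    uniaxialGrowth b c (sstar a b c) * (s - sstar a b c) ^ 2
      ≤ uniaxialPot a b c s - uniaxialPot a b c (sstar a b c) := by
  have h := sstar_root (b := b) ha hc
  have hB := three_mul_sstar_sub_pos ha hb hc
  set S := sstar a b c
  have key : uniaxialPot a b c s - uniaxialPot a b c S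
      - uniaxialGrowth b c S * (s - S) ^ 2
      = (s - S) ^ 2 * (c / 9 * s ^ 2 + 2 / 27 * (3 * S * c - b) * s) := by
    unfold uniaxialPot uniaxialGrowth
    linear_combination ((s ^ 2 - S ^ 2) / 9) * h
  have : 0 ≤ (s - S) ^ 2 * (c / 9 * s ^ 2 + 2 / 27 * (3 * S * c - b) * s) := by positivity
  linarith

/-- Lower bound for the excess potential in terms of the modulus `ρ` (with
`|Q|² = 2ρ²/3`) and the biaxiality `w`. -/
lemma potential_lower_bound {a b c s w ρ : ℝ} (ha : 0 ≤ a) (hb : 0 < b) (hc : 0 < c)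
    (hs : 0 ≤ s) (hw : 0 ≤ w) (hws : w ≤ s ^ 2) (hρ : 0 ≤ ρ) (hρs : ρ ^ 2 = s ^ 2 + 3 * w) :
    uniaxialGrowth b c (sstar a b c) * (ρ - sstar a b c) ^ 2 + b / 3 * (ρ * w)
      ≤ -(a / 2) * (2 / 3 * s ^ 2 + 2 * w) - (b / 3) * (2 / 9 * (s ^ 3 - 9 * s * w))
        + (c / 4) * (2 / 3 * s ^ 2 + 2 * w) ^ 2 - uniaxialPot a b c (sstar a b c) := by
  have h1 := uniaxialPot_growth ha hb hc hρ
  have hsρ : s ≤ ρ := abs_le_of_sq_le_sq' (by linarith) hρ |>.2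
  have hρ2 : ρ ≤ 2 * s := abs_le_of_sq_le_sq' (by nlinarith) (by positivity) |>.2
  have h3 : s ^ 3 ≤ ρ ^ 3 := pow_le_pow_left₀ hs hsρ 3
  have h4 : ρ * w ≤ 2 * s * w := mul_le_mul_of_nonneg_right hρ2 hw
  have key : -(a / 2) * (2 / 3 * s ^ 2 + 2 * w) - (b / 3) * (2 / 9 * (s ^ 3 - 9 * s * w))
        + (c / 4) * (2 / 3 * s ^ 2 + 2 * w) ^ 2
      = uniaxialPot a b c ρ + 2 * b / 27 * (ρ ^ 3 - s ^ 3 + 9 * s * w) := by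
    have hw' : w = (ρ ^ 2 - s ^ 2) / 3 := by linarith
    rw [hw']
    unfold uniaxialPot
    ring
  have h5 : b / 3 * (ρ * w) ≤ 2 * b / 27 * (ρ ^ 3 - s ^ 3 + 9 * s * w) := by
    have : b * (ρ * w) ≤ b * (2 * s * w) := mul_le_mul_of_nonneg_left h4 hb.le
    have : 0 ≤ b * (ρ ^ 3 - s ^ 3) := mul_nonneg hb.le (by linarith)
    linarith
  linarith

lemma dist_sq_upper_bound {s w ρ S : ℝ} (hS : 0 < S) (hs : 0 ≤ s) (hw : 0 ≤ w)
    (hρ : 0 ≤ ρ) (hρs : ρ ^ 2 = s ^ 2 + 3 * w) :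
    2 / 3 * (s - S) ^ 2 + 2 * w ≤ 4 * (ρ - S) ^ 2 + 16 / S * (ρ * w) := by
  have hsρ : s ≤ ρ := abs_le_of_sq_le_sq' (by linarith) hρ |>.2
  have hd : 2 / 3 * (s - S) ^ 2 + 2 * w = 2 / 3 * (ρ - S) ^ 2 + 4 / 3 * S * (ρ - s) := by
    linear_combination (-2 / 3) * hρs
  rcases le_or_gt (S / 2) ρ with h | h
  · have hρ0 : 0 < ρ := by linarith
    have h1 : (ρ - s) * ρ ≤ 3 * w := by nlinarith [mul_nonneg (sub_nonneg.2 hsρ) hs]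
    have h2 : S ^ 2 ≤ 4 * ρ ^ 2 := by nlinarith
    have h3 : S ^ 2 * (ρ - s) ≤ 12 * (ρ * w) := by
      have h5 := mul_le_mul_of_nonneg_right h2 (sub_nonneg.2 hsρ)
      have h6 := mul_le_mul_of_nonneg_left h1 hρ
      linarith
    have h4 : 4 / 3 * S * (ρ - s) ≤ 16 / S * (ρ * w) := by
      rw [div_mul_eq_mul_div 16, le_div_iff₀ hS]
      linarith
    nlinarith [sq_nonneg (ρ - S)]
  · have : 0 ≤ 16 / S * (ρ * w) := by positivity
    nlinarith [mul_nonneg hS.le hs]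

lemma uniaxialPot_le_gpot {a b c : ℝ} (ha : 0 ≤ a) (hb : 0 < b) (hc : 0 < c) {Q : Mat3}
    (hQ : isS0 Q) : uniaxialPot a b c (sstar a b c) ≤ gpot a b c Q := by
  obtain ⟨s, w, n, hs, hw, hws, -, -, h2, h3⟩ := exists_invariants_of_isS0 hQ
  have h := potential_lower_bound ha hb hc hs hw hws (Real.sqrt_nonneg _)
    (Real.sq_sqrt (show 0 ≤ s ^ 2 + 3 * w by positivity))
  have := uniaxialGrowth_pos ha hb hc
  have h0 : 0 ≤ uniaxialGrowth b c (sstar a b c) * (√(s ^ 2 + 3 * w) - sstar a b c) ^ 2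
      + b / 3 * (√(s ^ 2 + 3 * w) * w) := by positivity
  rw [gpot, h2, h3]
  linarith

lemma sub_uniaxialPot_le_fpot {a b c : ℝ} (ha : 0 ≤ a) (hb : 0 < b) (hc : 0 < c) (Q : Mat3) :
    gpot a b c Q - uniaxialPot a b c (sstar a b c) ≤ fpot a b c Q := by
  have hbdd : BddBelow (gpot a b c '' {Q | isS0 Q}) := by
    refine ⟨uniaxialPot a b c (sstar a b c), ?_⟩
    rintro _ ⟨P, hP, rfl⟩
    exact uniaxialPot_le_gpot ha hb hc hP
  have hez : ‖ez‖ = 1 := by simp [ez]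
  obtain ⟨hS0, h2, h3⟩ := isS0_and_traces_uniaxial (sstar a b c) hez
  have h := csInf_le hbdd (mem_image_of_mem (gpot a b c) hS0)
  have hval : gpot a b c (sstar a b c • (outer ez ez - (1 / 3 : ℝ) • (1 : Mat3)))
      = uniaxialPot a b c (sstar a b c) := by
    rw [gpot, h2, h3, uniaxialPot]
    ring
  rw [fpot, Cconst]
  linarith

lemma distUstar_sq_le (a b c : ℝ) {Q : Mat3} {n : E3} (hn : ‖n‖ = 1)
    (h : 0 ≤ mnormSq (Q - sstar a b c • (outer n n - (1 / 3 : ℝ) • (1 : Mat3)))) :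
    distUstar a b c Q ^ 2
      ≤ mnormSq (Q - sstar a b c • (outer n n - (1 / 3 : ℝ) • (1 : Mat3))) := by
  have hnonneg : ∀ d ∈ {d : ℝ | ∃ n : E3, ‖n‖ = 1 ∧
      d = mnorm (Q - sstar a b c • (outer n n - (1 / 3 : ℝ) • (1 : Mat3)))}, 0 ≤ d := by
    rintro _ ⟨m, -, rfl⟩
    exact Real.sqrt_nonneg _
  rw [← Real.sq_sqrt h]
  exact pow_le_pow_left₀ (Real.sInf_nonneg hnonneg) (csInf_le ⟨0, hnonneg⟩ ⟨n, hn, rfl⟩) 2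

/-- quadratic lower bound for the bulk potential in terms of the distance to
the uniaxial manifold: `dist(Q, U_*)² ≤ C₃ f(Q)` for all `Q ∈ S₀`, with `C₃ = C₃(a,b,c)`. -/
theorem dist_sq_le_potential
    (a b c : ℝ) (ha : 0 ≤ a) (hb : 0 < b) (hc : 0 < c) :
    ∃ C3 : ℝ, 0 < C3 ∧
      ∀ Q : Mat3, isS0 Q → (distUstar a b c Q) ^ 2 ≤ C3 * fpot a b c Q := by
  have hS := sstar_pos (a := a) hb hc
  have hD := uniaxialGrowth_pos ha hb hc
  set S := sstar a b c with hSdef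
  set D := uniaxialGrowth b c S
  refine ⟨4 / D + 48 / (b * S), by positivity, fun Q hQ => ?_⟩
  obtain ⟨s, w, n, hs, hw, hws, hn, hev, h2, h3⟩ := exists_invariants_of_isS0 hQ
  obtain ⟨ρ, hρ, hρs⟩ : ∃ ρ : ℝ, 0 ≤ ρ ∧ ρ ^ 2 = s ^ 2 + 3 * w :=
    ⟨√(s ^ 2 + 3 * w), Real.sqrt_nonneg _, Real.sq_sqrt (by positivity)⟩
  have hlow := potential_lower_bound ha hb hc hs hw hws hρ hρs
  have hup := dist_sq_upper_bound hS hs hw hρ hρs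
  have hf := sub_uniaxialPot_le_fpot ha hb hc Q
  rw [gpot, h2, h3] at hf
  have hnorm : mnormSq (Q - S • (outer n n - (1 / 3 : ℝ) • (1 : Mat3)))
      = 2 / 3 * (s - S) ^ 2 + 2 * w := by
    rw [mnormSq_sub_uniaxial hQ hn hev, h2]
    ring
  have hdist := distUstar_sq_le a b c hn (by rw [← hSdef, hnorm]; positivity)
  rw [← hSdef, hnorm] at hdist
  calc distUstar a b c Q ^ 2
      ≤ 4 * (ρ - S) ^ 2 + 16 / S * (ρ * w) := hdist.trans hup
    _ = 4 / D * (D * (ρ - S) ^ 2) + 48 / (b * S) * (b / 3 * (ρ * w)) := by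
        field_simp
        ring
    _ ≤ (4 / D + 48 / (b * S)) * (D * (ρ - S) ^ 2 + b / 3 * (ρ * w)) := by
        have e1 : 0 ≤ 4 / D * (b / 3 * (ρ * w)) := by positivity
        have e2 : 0 ≤ 48 / (b * S) * (D * (ρ - S) ^ 2) := by positivity
        linarith
    _ ≤ (4 / D + 48 / (b * S)) * fpot a b c Q :=
        mul_le_mul_of_nonneg_left (hlow.trans hf) (by positivity)
end
end

section
/- There exists a constant q₀ > 0 depending only on a, b, c (and not on L or W) such that any Q ∈ H_∞ solving the Euler–Lagrange equation L ΔQ = −aQ − b(Q² − (|Q|²/3)I) + c|Q|²Q in Ω, with either the weak anchoring condition (L/W) ∂Q/∂ν = Q_s − Q on |x| = 1 or the strong anchoring (Dirichlet) condition Q = Q_s on |x| = 1, satisfies ‖Q‖_{L∞(Ω)} ≤ q₀. -/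
open MeasureTheory Filter Metric Real Set
open scoped ENNReal NNReal
noncomputable section

open scoped Topology

def frobSq (A : Mat3) : ℝ := ∑ i, ∑ j, A i j ^ 2

theorem mnormSq_eq_frobSq {A : Mat3} (hA : A.IsSymm) : mnormSq A = frobSq A := by
  have h1 := hA.apply 0 1
  have h2 := hA.apply 0 2
  have h3 := hA.apply 1 2
  simp only [mnormSq, frobSq, Matrix.trace, Matrix.diag, Matrix.mul_apply, Fin.sum_univ_three]
  rw [h1, h2, h3]
  ring

theorem frobSq_nonneg (A : Mat3) : 0 ≤ frobSq A :=
  Finset.sum_nonneg fun _ _ => Finset.sum_nonneg fun _ _ => sq_nonneg _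

theorem frobSq_mul_self_le (A : Mat3) : frobSq (A * A) ≤ frobSq A ^ 2 := by
  have h : ∀ i j, (A * A) i j ^ 2 ≤ (∑ k, A i k ^ 2) * ∑ k, A k j ^ 2 := fun i j => by
    rw [Matrix.mul_apply]
    exact Finset.sum_mul_sq_le_sq_mul_sq _ _ _
  calc frobSq (A * A) ≤ ∑ i, ∑ j, (∑ k, A i k ^ 2) * ∑ k, A k j ^ 2 :=
        Finset.sum_le_sum fun i _ => Finset.sum_le_sum fun j _ => h i j
    _ = frobSq A ^ 2 := by
        simp only [frobSq, Fin.sum_univ_three]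
        ring

/-- The nonlinearity is coercive once the norm is large. -/
theorem coercive_gradf {a b c : ℝ} (hc : 0 < c) {A : Mat3} (hA : isS0 A)
    (hlarge : 4 * (a + b ^ 2 / c) / c ≤ frobSq A) :
    c * frobSq A ^ 2 ≤ 2 * ∑ i, ∑ j, A i j * gradf a b c A i j := by
  have htr : ∑ i, A i i = 0 := hA.2
  have hexp : ∑ i, ∑ j, A i j * gradf a b c A i j =
      -a * frobSq A - b * ∑ i, ∑ j, A i j * (A * A) i j + c * frobSq A ^ 2 := by
    have key : ∑ i, ∑ j, A i j * gradf a b c A i j =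
        -a * frobSq A - b * ∑ i, ∑ j, A i j * (A * A) i j
          + b * (mnormSq A / 3) * ∑ i, A i i + c * mnormSq A * frobSq A := by
      simp only [gradf, frobSq, Matrix.add_apply, Matrix.sub_apply, Matrix.smul_apply,
        smul_eq_mul, Fin.sum_univ_three, Matrix.one_apply]
      simp
      ring
    rw [key, htr, mnormSq_eq_frobSq hA.1]
    ring
  have hcubic : b * ∑ i, ∑ j, A i j * (A * A) i j ≤
      c / 4 * frobSq (A * A) + b ^ 2 / c * frobSq A := by
    simp only [frobSq, Finset.mul_sum, ← Finset.sum_add_distrib]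
    refine Finset.sum_le_sum fun i _ => Finset.sum_le_sum fun j _ => ?_
    have h : c / 4 * (A * A) i j ^ 2 + b ^ 2 / c * A i j ^ 2 - b * (A i j * (A * A) i j)
        = (c / 2 * (A * A) i j - b * A i j) ^ 2 / c := by
      field_simp
      ring
    have h' := div_nonneg (sq_nonneg (c / 2 * (A * A) i j - b * A i j)) hc.le
    linarith
  have hsq := mul_le_mul_of_nonneg_left (frobSq_mul_self_le A) (by positivity : 0 ≤ c / 4)
  have hu := frobSq_nonneg A
  rw [div_le_iff₀ hc] at hlarge
  have := mul_le_mul_of_nonneg_right hlarge hu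
  rw [hexp]
  nlinarith

theorem frobSq_Qsurf (a b c : ℝ) {x : E3} (hx : ‖x‖ = 1) :
    frobSq (Qsurf a b c x) = 2 / 3 * sstar a b c ^ 2 := by
  have h : x 0 ^ 2 + x 1 ^ 2 + x 2 ^ 2 = 1 := by
    have := EuclideanSpace.real_norm_sq_eq x
    rw [hx, Fin.sum_univ_three] at this
    linarith
  simp only [frobSq, Qsurf, er, hx, outer, Fin.sum_univ_three, Matrix.smul_apply,
    Matrix.sub_apply, Matrix.of_apply, Matrix.one_apply, smul_eq_mul]
  simp
  linear_combination (sstar a b c ^ 2 * (x 0 ^ 2 + x 1 ^ 2 + x 2 ^ 2 + 1 - 2 / 3)) * h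

theorem second_deriv_nonpos_of_isLocalMax {h h' : ℝ → ℝ} {d : ℝ} (hmax : IsLocalMax h 0)
    (hd : ∀ᶠ t in 𝓝 0, HasDerivAt h (h' t) t) (hd2 : HasDerivAt h' d 0) : d ≤ 0 := by
  by_contra! hpos
  have hderiv : deriv h =ᶠ[𝓝 0] h' := hd.mono fun t ht => ht.deriv
  have h2 : deriv (deriv h) 0 = d := by rw [hderiv.deriv_eq, hd2.deriv]
  have hmin : IsLocalMin h 0 := isLocalMin_of_deriv_deriv_pos (by rw [h2]; exact hpos)
    hmax.deriv_eq_zero hd.self_of_nhds.continuousAt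
  have hconst : h =ᶠ[𝓝 0] fun _ => h 0 := by
    filter_upwards [hmax, hmin] with t h1 h2 using le_antisymm h1 h2
  have h3 : deriv h =ᶠ[𝓝 0] deriv fun _ => h 0 := hconst.deriv
  have h4 := h3.deriv_eq
  rw [h2] at h4
  simp at h4
  exact hpos.ne' h4

theorem isOpen_Omega : IsOpen Omega := isOpen_lt continuous_const continuous_norm

theorem Omega_subset_OmegaBar : Omega ⊆ OmegaBar := fun x hx =>
  (show 1 < ‖x‖ from hx).le

theorem OmegaBar_mem_nhds {x : E3} (hx : x ∈ Omega) : OmegaBar ∈ 𝓝 x :=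
  mem_of_superset (isOpen_Omega.mem_nhds hx) Omega_subset_OmegaBar

theorem hasDerivAt_line (x v : E3) (t : ℝ) : HasDerivAt (fun t : ℝ => x + t • v) v t := by
  simpa using ((hasDerivAt_id t).smul_const v).const_add x

theorem hasDerivAt_pd {g : E3 → ℝ} {x : E3} (k : Fin 3) {t : ℝ}
    (ht : x + t • EuclideanSpace.single k (1 : ℝ) ∈ Omega)
    (hg : DifferentiableWithinAt ℝ g OmegaBar (x + t • EuclideanSpace.single k (1 : ℝ))) :
    HasDerivAt (fun t : ℝ => g (x + t • EuclideanSpace.single k (1 : ℝ)))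
      (pd g k (x + t • EuclideanSpace.single k (1 : ℝ))) t :=
  (hg.hasFDerivWithinAt.hasFDerivAt (OmegaBar_mem_nhds ht)).comp_hasDerivAt t
    (hasDerivAt_line x _ t)

theorem differentiableAt_pd {g : E3 → ℝ} (hg : ContDiffOn ℝ 2 g OmegaBar) {x : E3}
    (hx : x ∈ Omega) (k : Fin 3) : DifferentiableAt ℝ (pd g k) x := by
  have hev : pd g k =ᶠ[𝓝 x] fun y => fderiv ℝ g y (EuclideanSpace.single k 1) := by
    filter_upwards [isOpen_Omega.mem_nhds hx] with y hy
    simp only [pd, fderivWithin_of_mem_nhds (OmegaBar_mem_nhds hy)]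
  rw [hev.differentiableAt_iff]
  have h : ContDiffAt ℝ 1 (fderiv ℝ g) x :=
    (hg.contDiffAt (OmegaBar_mem_nhds hx)).fderiv_right (by norm_num)
  exact (h.differentiableAt (by norm_num)).clm_apply (differentiableAt_const _)

theorem eventually_line_mem_Omega {x : E3} (hx : x ∈ Omega) (v : E3) :
    ∀ᶠ t : ℝ in 𝓝 0, x + t • v ∈ Omega := by
  have h : Tendsto (fun t : ℝ => x + t • v) (𝓝 0) (𝓝 x) := by
    simpa using (hasDerivAt_line x v 0).continuousAt.tendsto
  exact h (isOpen_Omega.mem_nhds hx)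

theorem norm_sq_line (x : E3) (k : Fin 3) (t : ℝ) :
    ‖x + t • EuclideanSpace.single k (1 : ℝ)‖ ^ 2 = ‖x‖ ^ 2 + 2 * x k * t + t ^ 2 := by
  rw [EuclideanSpace.real_norm_sq_eq, EuclideanSpace.real_norm_sq_eq]
  fin_cases k <;> simp [Fin.sum_univ_three] <;> ring

theorem hasDerivAt_barrier {σ p A t : ℝ} (hs : σ - 2 * p * t - t ^ 2 ≠ 0) (n : ℕ) :
    HasDerivAt (fun t => A / (σ - 2 * p * t - t ^ 2) ^ n)
      (A * n * (2 * p + 2 * t) / (σ - 2 * p * t - t ^ 2) ^ (n + 1)) t := by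
  have h1 : HasDerivAt (fun t => σ - 2 * p * t - t ^ 2) (-(2 * p) - 2 * t) t := by
    simpa using (((hasDerivAt_id t).const_mul (2 * p)).const_sub σ).fun_sub (hasDerivAt_pow 2 t)
  have h2 := (hasDerivAt_const t A).fun_div (h1.fun_pow n) (pow_ne_zero n hs)
  refine h2.congr_deriv ?_
  cases n with
  | zero => simp
  | succ n =>
    simp only [Nat.add_sub_cancel]
    field_simp
    ring

/-- Second-order condition for `∑ (Q i j)²` touched from above by the barrier. -/
theorem laplacian_le_of_touching {Q : E3 → Mat3} (hQ : RegC 2 Q) {x : E3} (hx : x ∈ Omega)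
    {M A ρ : ℝ} (hρ : ‖x‖ ^ 2 < ρ)
    (hmax : IsLocalMax (fun y => frobSq (Q y) - (M + A / (ρ - ‖y‖ ^ 2) ^ 2)) x) :
    2 * ∑ i, ∑ j, Q x i j * matLap Q x i j ≤
      A * (12 / (ρ - ‖x‖ ^ 2) ^ 3 + 24 * ‖x‖ ^ 2 / (ρ - ‖x‖ ^ 2) ^ 4) := by
  have hσ : ρ - ‖x‖ ^ 2 ≠ 0 := (sub_pos.2 hρ).ne'
  set σ := ρ - ‖x‖ ^ 2 with hσdef
  have key : ∀ k : Fin 3, ∑ i, ∑ j, 2 * (Q x i j * pd (pd (fun y => Q y i j) k) k x) ≤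
      A * (4 / σ ^ 3 + 24 * x k ^ 2 / σ ^ 4) := by
    intro k
    set e : E3 := EuclideanSpace.single k (1 : ℝ) with he
    set g : Fin 3 → Fin 3 → ℝ → ℝ := fun i j t => Q (x + t • e) i j with hg
    set g' : Fin 3 → Fin 3 → ℝ → ℝ := fun i j t => pd (fun y => Q y i j) k (x + t • e) with hg'
    have hs : ∀ᶠ t : ℝ in 𝓝 0, σ - 2 * x k * t - t ^ 2 ≠ 0 := by
      have : ContinuousAt (fun t : ℝ => σ - 2 * x k * t - t ^ 2) 0 := by fun_prop
      exact this.eventually_ne (by simpa using hσ)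
    have hgd : ∀ t, x + t • e ∈ Omega → ∀ i j, HasDerivAt (g i j) (g' i j t) t := fun t ht i j =>
      hasDerivAt_pd k ht (((hQ i j).differentiableOn (by norm_num)) _ (Omega_subset_OmegaBar ht))
    have hg'd : ∀ i j, HasDerivAt (g' i j) (pd (pd (fun y => Q y i j) k) k x) 0 := fun i j => by
      have hx0 : x + (0 : ℝ) • e ∈ Omega := by simpa using hx
      have := hasDerivAt_pd (g := pd (fun y => Q y i j) k) (x := x) k (t := 0) hx0
        (differentiableAt_pd (hQ i j) hx0 k).differentiableWithinAt
      simpa [hg'] using this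
    have hd : ∀ᶠ t : ℝ in 𝓝 0, HasDerivAt
        (fun t => (∑ i, ∑ j, g i j t ^ 2) - (M + A / (σ - 2 * x k * t - t ^ 2) ^ 2))
        ((∑ i, ∑ j, 2 * (g i j t * g' i j t)) -
          (A * (2 : ℕ) * (2 * x k + 2 * t)) / (σ - 2 * x k * t - t ^ 2) ^ 3) t := by
      filter_upwards [hs, eventually_line_mem_Omega hx e] with t hst hmem
      refine HasDerivAt.fun_sub (HasDerivAt.fun_sum fun i _ => HasDerivAt.fun_sum fun j _ => ?_)
        ((hasDerivAt_barrier hst 2).const_add M)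
      refine ((hgd t hmem i j).fun_pow 2).congr_deriv ?_
      norm_num
      ring
    have hx0 : x + (0 : ℝ) • e ∈ Omega := by simpa using hx
    have hd2 : HasDerivAt (fun t => (∑ i, ∑ j, 2 * (g i j t * g' i j t)) -
          (A * (2 : ℕ) * (2 * x k + 2 * t)) / (σ - 2 * x k * t - t ^ 2) ^ 3)
        ((∑ i, ∑ j, 2 * (g' i j 0 * g' i j 0 + g i j 0 * pd (pd (fun y => Q y i j) k) k x)) -
          A * (4 / σ ^ 3 + 24 * x k ^ 2 / σ ^ 4)) 0 := by
      refine HasDerivAt.fun_sub (HasDerivAt.fun_sum fun i _ => HasDerivAt.fun_sum fun j _ => ?_) ?_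
      · exact ((hgd 0 hx0 i j).fun_mul (hg'd i j)).const_mul 2
      · have h1 : HasDerivAt (fun t : ℝ => A * (2 : ℕ) * (2 * x k + 2 * t)) (A * 4) 0 := by
          refine ((((hasDerivAt_id (0 : ℝ)).const_mul 2).const_add (2 * x k)).const_mul
            (A * (2 : ℕ))).congr_deriv ?_
          norm_num
          ring
        have h2 := h1.fun_mul (hasDerivAt_barrier (A := 1) hs.self_of_nhds 3)
        simp only [mul_one_div] at h2
        refine h2.congr_deriv ?_
        simp only [mul_zero, sub_zero, add_zero, one_mul, ne_eq, OfNat.ofNat_ne_zero,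
          not_false_eq_true, zero_pow]
        push_cast
        field_simp
        ring
    have hlm : IsLocalMax
        (fun t => (∑ i, ∑ j, g i j t ^ 2) - (M + A / (σ - 2 * x k * t - t ^ 2) ^ 2)) 0 := by
      have htend : Tendsto (fun t : ℝ => x + t • e) (𝓝 0) (𝓝 x) := by
        simpa using (hasDerivAt_line x e 0).continuousAt.tendsto
      filter_upwards [htend.eventually hmax] with t ht
      have hn : ρ - ‖x + t • e‖ ^ 2 = σ - 2 * x k * t - t ^ 2 := by
        rw [norm_sq_line]
        ring
      simp only [frobSq] at ht
      rw [hn] at ht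
      simpa [hg] using ht
    have hle := second_deriv_nonpos_of_isLocalMax hlm hd hd2
    have hsum : ∑ i, ∑ j, 2 * (Q x i j * pd (pd (fun y => Q y i j) k) k x) ≤
        ∑ i, ∑ j, 2 * (g' i j 0 * g' i j 0 + g i j 0 * pd (pd (fun y => Q y i j) k) k x) := by
      refine Finset.sum_le_sum fun i _ => Finset.sum_le_sum fun j _ => ?_
      have : g i j 0 = Q x i j := by simp [hg]
      rw [this]
      nlinarith [mul_self_nonneg (g' i j 0)]
    linarith
  have hnorm := EuclideanSpace.real_norm_sq_eq x
  rw [Fin.sum_univ_three] at hnorm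
  have h0 := key 0
  have h1 := key 1
  have h2 := key 2
  have e1 : 2 * ∑ i, ∑ j, Q x i j * matLap Q x i j =
      (∑ i, ∑ j, 2 * (Q x i j * pd (pd (fun y => Q y i j) 0) 0 x)) +
      (∑ i, ∑ j, 2 * (Q x i j * pd (pd (fun y => Q y i j) 1) 1 x)) +
      (∑ i, ∑ j, 2 * (Q x i j * pd (pd (fun y => Q y i j) 2) 2 x)) := by
    simp only [Finset.mul_sum, ← Finset.sum_add_distrib]
    refine Finset.sum_congr rfl fun i _ => Finset.sum_congr rfl fun j _ => ?_
    simp only [matLap, lap3, Matrix.of_apply, Fin.sum_univ_three]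
    ring
  have e2 : A * (12 / σ ^ 3 + 24 * ‖x‖ ^ 2 / σ ^ 4) =
      A * (4 / σ ^ 3 + 24 * x 0 ^ 2 / σ ^ 4) + A * (4 / σ ^ 3 + 24 * x 1 ^ 2 / σ ^ 4) +
      A * (4 / σ ^ 3 + 24 * x 2 ^ 2 / σ ^ 4) := by
    rw [hnorm]
    ring
  rw [e1, e2]
  linarith

/-- First-order condition at a boundary point for `∑ (Q i j)²` touched from above by the
barrier. -/
theorem nuDeriv_ge_of_touching {Q : E3 → Mat3} (hQ : RegC 2 Q) {x : E3} (hx : ‖x‖ = 1)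
    {M A ρ : ℝ} (hρ : 1 < ρ)
    (hmax : IsLocalMaxOn (fun y => frobSq (Q y) - (M + A / (ρ - ‖y‖ ^ 2) ^ 2)) OmegaBar x) :
    -(2 * ∑ i, ∑ j, Q x i j * nuDeriv Q x i j) ≤ 4 * A / (ρ - 1) ^ 3 := by
  have hmaps : ∀ t : ℝ, 0 ≤ t → x + t • x ∈ OmegaBar := fun t ht => by
    have : x + t • x = (1 + t) • x := by rw [add_smul, one_smul]
    rw [this]
    simp only [OmegaBar, mem_ofPred_eq, norm_smul, hx, mul_one, Real.norm_eq_abs]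
    rw [abs_of_nonneg (by linarith)]
    linarith
  have hline : HasDerivWithinAt (fun t : ℝ => x + t • x) x (Ici 0) 0 :=
    (hasDerivAt_line x x 0).hasDerivWithinAt
  have hgd : ∀ i j, HasDerivWithinAt (fun t : ℝ => Q (x + t • x) i j) (-nuDeriv Q x i j)
      (Ici 0) 0 := fun i j => by
    have hx0 : x + (0 : ℝ) • x = x := by simp
    have hf : HasFDerivWithinAt (fun y => Q y i j)
        (fderivWithin ℝ (fun y => Q y i j) OmegaBar x) OmegaBar (x + (0 : ℝ) • x) := by
      rw [hx0]
      exact ((hQ i j).differentiableOn (by norm_num) x hx.ge).hasFDerivWithinAt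
    have := hf.comp_hasDerivWithinAt (0 : ℝ) hline fun t ht => hmaps t ht
    simpa [nuDeriv, er, hx, Function.comp_def] using this
  have hb : HasDerivWithinAt (fun t : ℝ => M + A / ((ρ - 1) - 2 * 1 * t - t ^ 2) ^ 2)
      (4 * A / (ρ - 1) ^ 3) (Ici 0) 0 := by
    have hne : (ρ - 1) - 2 * 1 * 0 - (0 : ℝ) ^ 2 ≠ 0 := by simpa using (sub_pos.2 hρ).ne'
    have := ((hasDerivAt_barrier (A := A) hne 2).const_add M).hasDerivWithinAt (s := Ici 0)
    refine this.congr_deriv ?_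
    norm_num
    ring
  have hd : HasDerivWithinAt (fun t : ℝ => (∑ i, ∑ j, Q (x + t • x) i j ^ 2) -
      (M + A / ((ρ - 1) - 2 * 1 * t - t ^ 2) ^ 2))
      (-(2 * ∑ i, ∑ j, Q x i j * nuDeriv Q x i j) - 4 * A / (ρ - 1) ^ 3) (Ici 0) 0 := by
    refine HasDerivWithinAt.fun_sub ?_ hb
    have : HasDerivWithinAt (fun t : ℝ => ∑ i, ∑ j, Q (x + t • x) i j ^ 2)
        (∑ i, ∑ j, -(2 * (Q x i j * nuDeriv Q x i j))) (Ici 0) 0 := by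
      refine HasDerivWithinAt.fun_sum fun i _ => HasDerivWithinAt.fun_sum fun j _ => ?_
      refine ((hgd i j).fun_pow 2).congr_deriv ?_
      norm_num
      ring
    refine this.congr_deriv ?_
    simp only [Finset.mul_sum, Finset.sum_neg_distrib]
  have hlm : IsLocalMaxOn (fun t : ℝ => (∑ i, ∑ j, Q (x + t • x) i j ^ 2) -
      (M + A / ((ρ - 1) - 2 * 1 * t - t ^ 2) ^ 2)) (Ici 0) 0 := by
    have htend : Tendsto (fun t : ℝ => x + t • x) (𝓝[Ici 0] 0) (𝓝[OmegaBar] x) := by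
      refine tendsto_nhdsWithin_iff.2 ⟨?_, ?_⟩
      · simpa using hline.continuousWithinAt.tendsto
      · filter_upwards [self_mem_nhdsWithin] with t ht using hmaps t ht
    filter_upwards [htend.eventually hmax, self_mem_nhdsWithin] with t ht ht0
    have hn : ρ - ‖x + t • x‖ ^ 2 = (ρ - 1) - 2 * 1 * t - t ^ 2 := by
      have : x + t • x = (1 + t) • x := by rw [add_smul, one_smul]
      rw [this, norm_smul, hx, mul_one, Real.norm_eq_abs, sq_abs]
      ring
    simp only [frobSq] at ht
    rw [hn] at ht
    simpa [hx] using ht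
  have hone : (1 : ℝ) ∈ posTangentConeAt (Ici (0 : ℝ)) 0 := by
    refine mem_posTangentConeAt_of_segment_subset ?_
    rw [zero_add, segment_eq_Icc zero_le_one]
    exact Icc_subset_Ici_self
  have := hlm.hasFDerivWithinAt_nonpos hd.hasFDerivWithinAt hone
  simp at this
  linarith

theorem sum_mul_le_half (A B : Mat3) :
    ∑ i, ∑ j, A i j * B i j ≤ (frobSq A + frobSq B) / 2 := by
  simp only [frobSq, ← Finset.sum_add_distrib, Finset.sum_div]
  refine Finset.sum_le_sum fun i _ => Finset.sum_le_sum fun j _ => ?_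
  nlinarith [sq_nonneg (A i j - B i j)]

/-- Keller–Osserman type estimate on the shell `1 ≤ ‖x‖`, `‖x‖ ^ 2 < ρ`. -/
theorem frobSq_sub_mul_sq_le {a b c L M ρ κ : ℝ} (hc : 0 < c) (hL : 0 < L)
    (hM : 4 * (a + b ^ 2 / c) / c ≤ M) (hM0 : 0 ≤ M) {Q : E3 → Mat3} (hQ : RegC 2 Q)
    (hS : ∀ x ∈ OmegaBar, isS0 (Q x)) (hEL : isEL a b c L Q) (hρ : 1 < ρ)
    (hbdry : ∀ x : E3, ‖x‖ = 1 → M < frobSq (Q x) →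
      κ * (frobSq (Q x) - M) ≤ -(2 * ∑ i, ∑ j, Q x i j * nuDeriv Q x i j))
    (hκ : 4 < κ * (ρ - 1)) {x : E3} (hx : x ∈ OmegaBar) (hxρ : ‖x‖ ^ 2 < ρ) :
    (frobSq (Q x) - M) * (ρ - ‖x‖ ^ 2) ^ 2 ≤ 36 * L * ρ / c := by
  by_contra! hlt
  have hcont : ContinuousOn (fun y => (frobSq (Q y) - M) * (ρ - ‖y‖ ^ 2) ^ 2) OmegaBar := by
    have : ContinuousOn (fun y => frobSq (Q y)) OmegaBar :=
      continuousOn_finsetSum _ fun i _ => continuousOn_finsetSum _ fun j _ =>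
        (hQ i j).continuousOn.pow 2
    exact (this.sub continuousOn_const).mul (by fun_prop)
  have hclosed : IsClosed OmegaBar := isClosed_le continuous_const continuous_norm
  have hK : IsCompact (closedBall (0 : E3) (√ρ) ∩ OmegaBar) :=
    (isCompact_closedBall _ _).inter_right hclosed
  have hball : ∀ y : E3, y ∈ closedBall (0 : E3) (√ρ) ↔ ‖y‖ ^ 2 ≤ ρ := fun y => by
    rw [mem_closedBall_zero_iff, Real.le_sqrt (norm_nonneg _) (by linarith)]
  obtain ⟨x₀, ⟨hx₀ρ, hx₀⟩, hx₀max⟩ := hK.exists_isMaxOn ⟨x, (hball x).2 hxρ.le, hx⟩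
    (hcont.mono inter_subset_right)
  rw [hball] at hx₀ρ
  have hA := hlt.trans_le (hx₀max ⟨(hball x).2 hxρ.le, hx⟩)
  simp only at hA
  set A := (frobSq (Q x₀) - M) * (ρ - ‖x₀‖ ^ 2) ^ 2 with hAdef
  have hApos : 0 < A := lt_trans (by positivity) hA
  have hσ : 0 < ρ - ‖x₀‖ ^ 2 := by
    rcases hx₀ρ.lt_or_eq with h | h
    · exact sub_pos.2 h
    · rw [hAdef, h] at hApos
      simp at hApos
  have hu : M < frobSq (Q x₀) := sub_pos.1 ((pos_iff_pos_of_mul_pos hApos).2 (by positivity))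
  have hAdiv : A / (ρ - ‖x₀‖ ^ 2) ^ 2 = frobSq (Q x₀) - M := by
    rw [hAdef]
    field_simp
  have hmax : IsLocalMaxOn (fun y => frobSq (Q y) - (M + A / (ρ - ‖y‖ ^ 2) ^ 2)) OmegaBar x₀ := by
    have hnear : ∀ᶠ y in 𝓝 x₀, ‖y‖ ^ 2 < ρ :=
      (by fun_prop : ContinuousAt (fun y : E3 => ‖y‖ ^ 2) x₀).eventually_lt_const (sub_pos.1 hσ)
    filter_upwards [nhdsWithin_le_nhds hnear, self_mem_nhdsWithin] with y hy hyΩ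
    have hle : (frobSq (Q y) - M) * (ρ - ‖y‖ ^ 2) ^ 2 ≤ A := hx₀max ⟨(hball y).2 hy.le, hyΩ⟩
    rw [← le_div_iff₀ (pow_pos (sub_pos.2 hy) 2)] at hle
    linarith
  rcases (show 1 ≤ ‖x₀‖ from hx₀).eq_or_lt with h1 | h1
  · have hd := nuDeriv_ge_of_touching hQ h1.symm hρ hmax
    have hB := hbdry x₀ h1.symm hu
    have hρ1 : 0 < ρ - 1 := by linarith
    rw [← h1, one_pow] at hAdiv
    have : 4 * A / (ρ - 1) ^ 3 = 4 * (frobSq (Q x₀) - M) / (ρ - 1) := by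
      rw [← hAdiv]
      field_simp
    rw [this, le_div_iff₀ hρ1] at hd
    have h2 := mul_le_mul_of_nonneg_right hB hρ1.le
    nlinarith
  · have hΩ : x₀ ∈ Omega := h1
    have hlap := laplacian_le_of_touching hQ hΩ (sub_pos.1 hσ)
      (hmax.isLocalMax (OmegaBar_mem_nhds hΩ))
    have hcoer := coercive_gradf (b := b) hc (hS x₀ hx₀) (hM.trans hu.le)
    have hEL' : ∑ i, ∑ j, Q x₀ i j * gradf a b c (Q x₀) i j =
        L * ∑ i, ∑ j, Q x₀ i j * matLap Q x₀ i j := by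
      rw [← hEL x₀ hΩ]
      simp only [Finset.mul_sum, Matrix.smul_apply, smul_eq_mul]
      exact Finset.sum_congr rfl fun i _ => Finset.sum_congr rfl fun j _ => by ring
    rw [hEL'] at hcoer
    set σ := ρ - ‖x₀‖ ^ 2 with hσdef
    have hbar : A * (12 / σ ^ 3 + 24 * ‖x₀‖ ^ 2 / σ ^ 4) ≤ A * (36 * ρ / σ ^ 4) := by
      have : 12 / σ ^ 3 + 24 * ‖x₀‖ ^ 2 / σ ^ 4 = (12 * σ + 24 * ‖x₀‖ ^ 2) / σ ^ 4 := by
        field_simp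
      rw [this]
      gcongr
      nlinarith [sq_nonneg ‖x₀‖]
    have hsq : (A / σ ^ 2) ^ 2 ≤ frobSq (Q x₀) ^ 2 := by
      rw [hAdiv]
      have : 0 ≤ frobSq (Q x₀) - M := by linarith
      gcongr
      linarith
    have h3 : c * (A / σ ^ 2) ^ 2 ≤ L * (A * (36 * ρ / σ ^ 4)) := by
      have := mul_le_mul_of_nonneg_left (hlap.trans hbar) hL.le
      have := mul_le_mul_of_nonneg_left hsq hc.le
      linarith
    have h4 : c * (A / σ ^ 2) ^ 2 = c * A * (A / σ ^ 4) := by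
      field_simp
    have h5 : L * (A * (36 * ρ / σ ^ 4)) = 36 * L * ρ * (A / σ ^ 4) := by ring
    rw [h4, h5] at h3
    have h6 := le_of_mul_le_mul_right h3 (by positivity)
    rw [div_lt_iff₀ hc] at hA
    linarith

theorem weakAnchor_nuDeriv_bound {a b c L W M : ℝ} (hL : 0 < L) (hW : 0 < W)
    (hM : sstar a b c ^ 2 ≤ M) {Q : E3 → Mat3} (hwa : weakAnchor a b c L W Q) {x : E3}
    (hx : ‖x‖ = 1) :
    W / L * (frobSq (Q x) - M) ≤ -(2 * ∑ i, ∑ j, Q x i j * nuDeriv Q x i j) := by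
  have h := hwa x hx
  have e : L / W * ∑ i, ∑ j, Q x i j * nuDeriv Q x i j =
      (∑ i, ∑ j, Q x i j * Qsurf a b c x i j) - frobSq (Q x) := by
    simp only [frobSq, Finset.mul_sum, ← Finset.sum_sub_distrib]
    refine Finset.sum_congr rfl fun i _ => Finset.sum_congr rfl fun j _ => ?_
    have hij := congrFun (congrFun h i) j
    simp only [Matrix.smul_apply, Matrix.sub_apply, smul_eq_mul] at hij
    linear_combination Q x i j * hij
  have hcs := sum_mul_le_half (Q x) (Qsurf a b c x)
  rw [frobSq_Qsurf a b c hx] at hcs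
  have hle : frobSq (Q x) - M ≤ -(2 * (L / W * ∑ i, ∑ j, Q x i j * nuDeriv Q x i j)) := by
    rw [e]
    nlinarith [sq_nonneg (sstar a b c)]
  have := mul_le_mul_of_nonneg_left hle (by positivity : 0 ≤ W / L)
  refine this.trans_eq ?_
  field_simp

theorem frobSq_le {a b c L M κ : ℝ} (hc : 0 < c) (hL : 0 < L)
    (hM : 4 * (a + b ^ 2 / c) / c ≤ M) (hM0 : 0 ≤ M) {Q : E3 → Mat3} (hQ : RegC 2 Q)
    (hS : ∀ x ∈ OmegaBar, isS0 (Q x)) (hEL : isEL a b c L Q) (hκ : 0 < κ)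
    (hbdry : ∀ x : E3, ‖x‖ = 1 → M < frobSq (Q x) →
      κ * (frobSq (Q x) - M) ≤ -(2 * ∑ i, ∑ j, Q x i j * nuDeriv Q x i j))
    {x : E3} (hx : x ∈ OmegaBar) : frobSq (Q x) ≤ M := by
  by_contra! hlt
  have hδ : 0 < frobSq (Q x) - M := sub_pos.2 hlt
  set δ := frobSq (Q x) - M with hδdef
  have hev : ∀ᶠ ρ : ℝ in atTop, 1 < ρ ∧ 4 / κ + 1 < ρ ∧ 2 * ‖x‖ ^ 2 < ρ ∧
      144 * L / c / δ < ρ :=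
    (eventually_gt_atTop _).and ((eventually_gt_atTop _).and
      ((eventually_gt_atTop _).and (eventually_gt_atTop _)))
  obtain ⟨ρ, h1, h2, h3, h4⟩ := hev.exists
  have hκ' : 4 < κ * (ρ - 1) := by
    have : 4 / κ < ρ - 1 := by linarith
    rw [div_lt_iff₀ hκ] at this
    linarith
  have := frobSq_sub_mul_sq_le hc hL hM hM0 hQ hS hEL h1 hbdry hκ' hx
    (by nlinarith [sq_nonneg ‖x‖])
  rw [div_lt_iff₀ hδ] at h4
  have h5 : (ρ / 2) ^ 2 ≤ (ρ - ‖x‖ ^ 2) ^ 2 := by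
    gcongr
    linarith
  have h6 := mul_le_mul_of_nonneg_left h5 hδ.le
  have h7 : 36 * L * ρ / c = 144 * L / c * (ρ / 4) := by ring
  rw [h7] at this
  have h8 := mul_lt_mul_of_pos_right h4 (by linarith : 0 < ρ / 4)
  nlinarith

/-- Lemma 2.2: uniform `L∞` bound, independent of `L` and `W`, for
solutions of the Euler–Lagrange equations with weak (`W < ∞`) or strong (`W = ∞`,
Dirichlet) anchoring. -/
theorem uniform_Linfty_bound
    (a b c : ℝ) (ha : 0 ≤ a) (hb : 0 < b) (hc : 0 < c) :
    ∃ q0 : ℝ, 0 < q0 ∧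
      ∀ (L : ℝ) (W : ℝ≥0∞), 0 < L → 0 < W →
        ∀ Q : E3 → Mat3, RegC 2 Q → memH a b c Q → isEL a b c L Q →
          ((W ≠ ⊤ ∧ weakAnchor a b c L W.toReal Q) ∨
           (W = ⊤ ∧ ∀ x : E3, ‖x‖ = 1 → Q x = Qsurf a b c x)) →
          ∀ x ∈ OmegaBar, mnorm (Q x) ≤ q0 := by
  set M : ℝ := 4 * (a + b ^ 2 / c) / c + sstar a b c ^ 2 with hMdef
  have hMpos : 0 < M := by positivity
  have hM1 : 4 * (a + b ^ 2 / c) / c ≤ M := le_add_of_nonneg_right (sq_nonneg _)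
  have hM2 : sstar a b c ^ 2 ≤ M := le_add_of_nonneg_left (by positivity)
  refine ⟨√M, Real.sqrt_pos.2 hMpos, fun L W hL hW Q hQ hH hEL hbc x hx => ?_⟩
  rw [mnorm, mnormSq_eq_frobSq (hH.1 x hx).1]
  refine Real.sqrt_le_sqrt ?_
  rcases hbc with ⟨hWtop, hwa⟩ | ⟨-, hD⟩
  · have hWpos : 0 < W.toReal := ENNReal.toReal_pos hW.ne' hWtop
    exact frobSq_le hc hL hM1 hMpos.le hQ hH.1 hEL (div_pos hWpos hL)
      (fun y hy _ => weakAnchor_nuDeriv_bound hL hWpos hM2 hwa hy) hx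
  · refine frobSq_le hc hL hM1 hMpos.le hQ hH.1 hEL one_pos (fun y hy hlt => ?_) hx
    rw [hD y hy, frobSq_Qsurf a b c hy] at hlt
    nlinarith [sq_nonneg (sstar a b c)]
end
end
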